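/- Let d = s(q−1) + Δ and d' = s'(q−1) + Δ, where gcd(Δ, q−1) = 1. Then γ^{−d} and γ^{−d'} have the same minimal polynomial over F_p (i.e., h_d(x) = h_{d'}(x)) if and only if s ≡ s' (mod q+1) or s ≡ Δ − s' (mod q+1). -/

import Mathlib

/-- Two elements of a finite field of characteristic `p` have the same minimal polynomial over the
prime field iff one is an iterated Frobenius image of the other. -/
theorem minpoly_eq_iff_exists_pow_prime_pow {p : ℕ} [Fact p.Prime] {F : Type*} [Field F] [Finite F]
    [Algebra (ZMod p) F] (x y : F) :
    minpoly (ZMod p) x = minpoly (ZMod p) y ↔ ∃ k : ℕ, y ^ p ^ k = x := by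
  have frob (k : ℕ) : (FiniteField.frobeniusAlgEquivOfAlgebraic (ZMod p) F ^ k) y = y ^ p ^ k := by
    rw [AlgEquiv.coe_pow, FiniteField.coe_frobeniusAlgEquivOfAlgebraic_iterate, ZMod.card]
  rw [← isConjRoot_def, isConjRoot_iff_exists_algEquiv]
  constructor
  · rintro ⟨σ, rfl⟩
    obtain ⟨k, rfl⟩ :=
      (FiniteField.bijective_frobeniusAlgEquivOfAlgebraic_pow (ZMod p) F).surjective σ
    exact ⟨k, (frob k).symm⟩
  · rintro ⟨k, rfl⟩
    exact ⟨_, frob k⟩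

theorem Int.dvd_of_pow_sub_one_dvd_pow_sub_one {a m k : ℕ} (ha : 1 < a)
    (h : (a : ℤ) ^ m - 1 ∣ (a : ℤ) ^ k - 1) : m ∣ k := by
  have h_nat : a ^ m - 1 ∣ a ^ k - 1 := by
    zify [Nat.one_le_pow m a (by lia), Nat.one_le_pow k a (by lia)]
    exact h
  have h_gcd := Nat.gcd_eq_left h_nat
  rw [Nat.pow_sub_one_gcd_pow_sub_one] at h_gcd
  have h_pow : a ^ m.gcd k = a ^ m := by
    have := Nat.one_le_pow m a (by lia)
    have := Nat.one_le_pow (m.gcd k) a (by lia)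
    lia
  exact Nat.gcd_eq_left_iff_dvd.mp (Nat.pow_right_injective ha h_pow)

/-- Powers of `q` modulo `q ^ 2 - 1` are `1` or `q`. -/
theorem Int.pow_modEq_one_or_self (q : ℤ) (j : ℕ) :
    q ^ j ≡ 1 [ZMOD q ^ 2 - 1] ∨ q ^ j ≡ q [ZMOD q ^ 2 - 1] := by
  have h_sq : q ^ 2 ≡ 1 [ZMOD q ^ 2 - 1] := (Int.modEq_sub (q ^ 2) 1)
  obtain ⟨i, rfl | rfl⟩ := j.even_or_odd'
  · left
    simpa [pow_mul] using h_sq.pow i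
  · right
    simpa [pow_mul, pow_succ] using (h_sq.pow i).mul_right q


/-- Lemma 1(2): Let `p` be a prime, `m ≥ 1`, `q = p^m`, `F` the finite field with `q²`
elements and `γ` a generator of `Fˣ`.  If `d = s(q-1) + Δ` and `d' = s'(q-1) + Δ` with
`gcd(Δ, q-1) = 1`, then `γ^{-d}` and `γ^{-d'}` have the same minimal polynomial over `F_p`
if and only if `s ≡ s' (mod q+1)` or `s ≡ Δ - s' (mod q+1)`. -/
theorem stmt_1 (p m : ℕ) (hp : p.Prime) (hm : 0 < m) (q : ℕ) (hq : q = p ^ m)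
    (F : Type*) [Field F] [Fintype F] [Algebra (ZMod p) F]
    (hF : Fintype.card F = q ^ 2)
    (γ : Fˣ) (hγ : ∀ x : Fˣ, x ∈ Subgroup.zpowers γ)
    (d d' s s' Δ : ℤ) (hΔ : Int.gcd Δ ((q : ℤ) - 1) = 1)
    (hd : d = s * ((q : ℤ) - 1) + Δ) (hd' : d' = s' * ((q : ℤ) - 1) + Δ) :
    minpoly (ZMod p) ((γ ^ (-d) : Fˣ) : F) = minpoly (ZMod p) ((γ ^ (-d') : Fˣ) : F) ↔
      (s ≡ s' [ZMOD ((q : ℤ) + 1)] ∨ s ≡ Δ - s' [ZMOD ((q : ℤ) + 1)]) := by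
  have : Fact p.Prime := ⟨hp⟩
  have hq_one : 1 < q := hq ▸ Nat.one_lt_pow hm.ne' hp.one_lt
  have h_order : (orderOf γ : ℤ) = (q : ℤ) ^ 2 - 1 := by
    rw [orderOf_eq_card_of_forall_mem_zpowers hγ, Nat.card_units, Nat.card_eq_fintype_card, hF,
      Nat.cast_sub (Nat.one_le_pow _ _ (by lia))]
    simp
  have h_factor : (q : ℤ) ^ 2 - 1 = (q - 1) * (q + 1) := by ring
  have hq_sub : (q : ℤ) - 1 ≠ 0 := by lia
  have h_pow (k : ℕ) : ((γ ^ (-d') : Fˣ) : F) ^ p ^ k = ((γ ^ (-d) : Fˣ) : F) ↔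
      (q : ℤ) ^ 2 - 1 ∣ (p : ℤ) ^ k * d' - d := by
    rw [← Units.val_pow_eq_pow_val, Units.val_inj, ← zpow_natCast, ← zpow_mul,
      zpow_eq_zpow_iff_modEq, Int.modEq_iff_dvd, h_order]
    push_cast
    rw [show -d - -d' * (p : ℤ) ^ k = (p : ℤ) ^ k * d' - d by ring]
  have h_one : (q : ℤ) ^ 2 - 1 ∣ d' - d ↔ s ≡ s' [ZMOD (q : ℤ) + 1] := by
    rw [hd, hd', h_factor, Int.modEq_iff_dvd,
      show s' * ((q : ℤ) - 1) + Δ - (s * (q - 1) + Δ) = (q - 1) * (s' - s) by ring,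
      mul_dvd_mul_iff_left hq_sub]
  have h_self : (q : ℤ) ^ 2 - 1 ∣ q * d' - d ↔ s ≡ Δ - s' [ZMOD (q : ℤ) + 1] := by
    rw [hd, hd', h_factor, Int.modEq_iff_dvd,
      show (q : ℤ) * (s' * ((q : ℤ) - 1) + Δ) - (s * (q - 1) + Δ) =
        (q - 1) * (Δ - s' - s + (q + 1) * s') by ring,
      mul_dvd_mul_iff_left hq_sub, dvd_add_left (dvd_mul_right _ _)]
  rw [minpoly_eq_iff_exists_pow_prime_pow, ← h_one, ← h_self]
  simp_rw [h_pow]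
  constructor
  · rintro ⟨k, hk⟩
    have h_dvd : (p : ℤ) ^ m - 1 ∣ (p : ℤ) ^ k - 1 := by
      have h_mul : (q : ℤ) - 1 ∣ ((p : ℤ) ^ k - 1) * Δ := by
        have h_lin : (p : ℤ) ^ k * d' - d =
            ((p : ℤ) ^ k - 1) * Δ + (q - 1) * ((p : ℤ) ^ k * s' - s) := by
          rw [hd, hd']; ring
        rw [h_factor, h_lin] at hk
        exact (dvd_add_left (dvd_mul_right _ _)).mp ((dvd_mul_right _ _).trans hk)
      have h_cop : IsCoprime ((q : ℤ) - 1) Δ := (Int.isCoprime_iff_gcd_eq_one.mpr hΔ).symm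
      simpa [hq] using h_cop.dvd_of_dvd_mul_right h_mul
    obtain ⟨j, rfl⟩ := Int.dvd_of_pow_sub_one_dvd_pow_sub_one hp.one_lt h_dvd
    rw [pow_mul, ← Nat.cast_pow p, ← hq, ← Int.modEq_iff_dvd] at hk
    refine (Int.pow_modEq_one_or_self q j).imp (fun h => ?_) fun h => ?_
    · simpa using (hk.trans (h.mul_right d')).dvd
    · exact (hk.trans (h.mul_right d')).dvd
  · rintro (h | h)
    · exact ⟨0, by simpa using h⟩
    · exact ⟨m, by simpa [hq] using h⟩
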